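/- Assume F satisfies conditions (i) and (ii), and set W_{F,q} := {u ∈ F_q : F(u) = 0}. Then the image α_F(F_q) equals the set {a ∈ F_q : Tr_{F_q/F_p}(u·R_F(u) + a·u²) = 0 for all u ∈ W_{F,q}}. -/

import Mathlib

open Finset

open scoped Classical

noncomputable section

/-- Length-two Witt vectors, with the operations specialised to characteristic two. -/
def W2 (R : Type*) := R × R

namespace W2

variable {R : Type*} [CommRing R]

instance : Zero (W2 R) := ⟨((0, 0) : R × R)⟩

instance : Add (W2 R) := ⟨fun x y => ((x.1 + y.1, x.2 + y.2 + x.1 * y.1) : R × R)⟩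

instance [CharP R 2] : Neg (W2 R) := ⟨fun x => ((x.1, x.2 + x.1 * x.1) : R × R)⟩

theorem fst_add (x y : W2 R) : (x + y).1 = x.1 + y.1 := rfl
theorem snd_add (x y : W2 R) : (x + y).2 = x.2 + y.2 + x.1 * y.1 := rfl
theorem fst_zero : (0 : W2 R).1 = 0 := rfl
theorem snd_zero : (0 : W2 R).2 = 0 := rfl
theorem fst_neg [CharP R 2] (x : W2 R) : (-x).1 = x.1 := rfl
theorem snd_neg [CharP R 2] (x : W2 R) : (-x).2 = x.2 + x.1 * x.1 := rfl

instance [CharP R 2] : AddCommGroup (W2 R) where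
  add := (· + ·)
  zero := 0
  neg := Neg.neg
  add_assoc a b c := Prod.ext_iff.mpr (by
    constructor <;> simp only [fst_add, snd_add] <;> ring)
  zero_add a := Prod.ext_iff.mpr (by
    constructor <;> simp [fst_add, snd_add, fst_zero, snd_zero])
  add_zero a := Prod.ext_iff.mpr (by
    constructor <;> simp [fst_add, snd_add, fst_zero, snd_zero])
  add_comm a b := Prod.ext_iff.mpr (by
    constructor <;> simp only [fst_add, snd_add] <;> ring)
  neg_add_cancel a := Prod.ext_iff.mpr (by
    constructor
    · simp only [fst_add, fst_neg, fst_zero]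
      exact CharTwo.add_self_eq_zero a.1
    · simp only [snd_add, snd_neg, snd_zero, fst_neg]
      rw [show a.2 + a.1 * a.1 + a.2 + a.1 * a.1
            = (a.2 + a.2) + (a.1 * a.1 + a.1 * a.1) by ring]
      rw [CharTwo.add_self_eq_zero, CharTwo.add_self_eq_zero, add_zero])
  nsmul := nsmulRec
  zsmul := zsmulRec

/-- Frobenius on length-two Witt vectors (characteristic two). -/
def frob (x : W2 R) : W2 R := ((x.1 ^ 2, x.2 ^ 2) : R × R)

/-- The Witt-vector trace `Tr_{q/2} = ∑_{i=0}^{n-1} Frobⁱ`. -/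
def tr [CharP R 2] (n : ℕ) (x : W2 R) : W2 R := ∑ i ∈ Finset.range n, frob^[i] x

/-- The additive character of `W₂(𝔽₂)` determined by `ξ₂(1,0) = I`
(for `I` a fixed primitive fourth root of unity), evaluated on Witt vectors
whose components lie in the prime field `𝔽₂ = {0,1}`. -/
def xi (I : ℂ) (x : W2 R) : ℂ := (if x.1 = 0 then 1 else I) * (if x.2 = 0 then 1 else -1)

end W2

variable {K : Type*}

/-- The absolute trace `Tr_{q/2} : 𝔽_q → 𝔽₂`, computed inside `K` (here `q = 2^n`). -/
def tr2 [Field K] (n : ℕ) (x : K) : K := ∑ i ∈ Finset.range n, x ^ 2 ^ i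

/-- The relative trace `Tr_{q/p} : 𝔽_q → 𝔽_p ⊆ 𝔽_q`, computed inside `K`
(here `q = p^m`). -/
def trp [Field K] (p m : ℕ) (x : K) : K := ∑ i ∈ Finset.range m, x ^ p ^ i

/-- The character `ψ_q(x) = (-1)^{Tr_{q/2}(x)}`. -/
def psiq [Field K] (n : ℕ) (x : K) : ℂ := if tr2 n x = 0 then 1 else -1

/-- The map `Q_q(x) = ξ₂(Tr_{q/2}(x,0))` on Witt vectors of length two. -/
def Qq [Field K] [CharP K 2] (I : ℂ) (n : ℕ) (x : K) : ℂ :=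
  W2.xi I (W2.tr n (((x, 0) : K × K) : W2 K))

/-- The unique `2^j`-th root in a perfect field of characteristic two. -/
def rt (L : Type*) [Field L] [ExpChar L 2] [PerfectRing L 2] (j : ℕ) (x : L) : L :=
  (fun y => (frobeniusEquiv L 2).symm y)^[j] x

/-- Evaluation of the `𝔽_p`-linearised polynomial `∑_{i=0}^{e} c_i x^{p^i}`. -/
def Lpoly [Field K] (p e : ℕ) (c : ℕ → K) (x : K) : K :=
  ∑ i ∈ Finset.range (e + 1), c i * x ^ p ^ i

/-- The adjoint `f^*(x) = ∑_{i=0}^{e} (c_i x)^{p^{-i}}` (with `p = 2^k`). -/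
def adj [Field K] [ExpChar K 2] [PerfectRing K 2] (k e : ℕ) (c : ℕ → K) (x : K) : K :=
  ∑ i ∈ Finset.range (e + 1), rt K (k * i) (c i * x)

/-- Evaluation of the `𝔽_p`-linearised polynomial `∑_{i=1}^{e} c_i x^{p^i}`
(no constant-in-`x` coefficient). -/
def LpolyIcc [Field K] (p e : ℕ) (c : ℕ → K) (x : K) : K :=
  ∑ i ∈ Finset.Icc 1 e, c i * x ^ p ^ i

/-- The adjoint `R^*(x) = ∑_{i=1}^{e} (c_i x)^{p^{-i}}` (with `p = 2^k`). -/
def adjIcc [Field K] [ExpChar K 2] [PerfectRing K 2] (k e : ℕ) (c : ℕ → K) (x : K) : K :=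
  ∑ i ∈ Finset.Icc 1 e, rt K (k * i) (c i * x)

/-- The coefficients `a_i = ∑_{j=0}^{e-i} (b_j b_{j+i})^{p^{-j}}` of `R_F` (with `p = 2^k`). -/
def aRF [Field K] [ExpChar K 2] [PerfectRing K 2] (k e : ℕ) (b : ℕ → K) (i : ℕ) : K :=
  ∑ j ∈ Finset.range (e - i + 1), rt K (k * j) (b j * b (j + i))

/-- The linearised polynomial `R_F(x) = ∑_{i=1}^{e} a_i x^{p^i}` (with `p = 2^k`). -/
def RF [Field K] [ExpChar K 2] [PerfectRing K 2] (k e : ℕ) (b : ℕ → K) (x : K) : K :=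
  ∑ i ∈ Finset.Icc 1 e, aRF k e b i * x ^ (2 ^ k) ^ i

/-- `γ_F = ∑_{0 ≤ i < j ≤ e} b_i^{p^{-i}} b_j^{p^{-j}}` (with `p = 2^k`). -/
def gammaF [Field K] [ExpChar K 2] [PerfectRing K 2] (k e : ℕ) (b : ℕ → K) : K :=
  ∑ i ∈ Finset.range (e + 1), ∑ j ∈ Finset.Ioo i (e + 1), rt K (k * i) (b i) * rt K (k * j) (b j)

/-- `α_F(t) = γ_F + F^*(t)²`. -/
def alphaF [Field K] [ExpChar K 2] [PerfectRing K 2] (k e : ℕ) (b : ℕ → K) (t : K) : K :=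
  gammaF k e b + adj k e b t ^ 2

/-- `R_{F,t}(x) = R_F(x) + α_F(t) x`. -/
def RFt [Field K] [ExpChar K 2] [PerfectRing K 2] (k e : ℕ) (b : ℕ → K) (t x : K) : K :=
  RF k e b x + alphaF k e b t * x

/-- The number of affine points of the van der Geer–van der Vlugt curve
`y^p - y = x R(x)` with coordinates in `K`. -/
def Ncount (K : Type*) [Field K] (p : ℕ) (R : K → K) : ℕ :=
  Nat.card {z : K × K // z.2 ^ p - z.2 = z.1 * R z.1}

/-- The adjoint `F^*` of `F(x) = ∑_{i=0}^{e} b_i x^{p^i}`, with coefficients `b_i ∈ K`,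
viewed as a function on the algebraic closure `𝔽` of `K`. -/
def adjBar [Field K] [CharP K 2] (k e : ℕ) (b : ℕ → K) (x : AlgebraicClosure K) : AlgebraicClosure K :=
  adj k e (fun i => algebraMap K (AlgebraicClosure K) (b i)) x

/-- `F(x) = ∑_{i=0}^{e} b_i x^{p^i}`, with coefficients `b_i ∈ K`, viewed as a function on
the algebraic closure `𝔽` of `K` (with `p = 2^k`). -/
def LpolyBar [Field K] [CharP K 2] (k e : ℕ) (b : ℕ → K) (x : AlgebraicClosure K) : AlgebraicClosure K :=
  Lpoly (2 ^ k) e (fun i => algebraMap K (AlgebraicClosure K) (b i)) x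


theorem rt_pow {L : Type*} [Field L] [ExpChar L 2] [PerfectRing L 2] (j : ℕ) (x : L) :
    rt L j x ^ 2 ^ j = x := by
  unfold rt
  induction j generalizing x with
  | zero => simp
  | succ j ih =>
    rw [Function.iterate_succ_apply', pow_succ', pow_mul, frobeniusEquiv_symm_pow_p, ih]

theorem pow2_inj {L : Type*} [Field L] [ExpChar L 2] (j : ℕ) {x y : L}
    (h : x ^ 2 ^ j = y ^ 2 ^ j) : x = y := by
  have := iterateFrobenius_inj L 2 j
  exact this (by simpa [iterateFrobenius_def] using h)

theorem rt_eq {L : Type*} [Field L] [ExpChar L 2] [PerfectRing L 2] (j : ℕ) {x y : L}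
    (h : y ^ 2 ^ j = x) : rt L j x = y :=
  pow2_inj j (by rw [rt_pow, h])

/-- constructor for length two Witt vectors -/
def mkW {K : Type*} (x y : K) : W2 K := ((x, y) : K × K)

theorem mkW_fst {K : Type*} (x y : K) : (mkW x y).1 = x := rfl
theorem mkW_snd {K : Type*} (x y : K) : (mkW x y).2 = y := rfl

theorem W2ext {K : Type*} {x y : W2 K} (h1 : x.1 = y.1) (h2 : x.2 = y.2) : x = y :=
  Prod.ext_iff.mpr ⟨h1, h2⟩

/-- power Frobenius on length two Witt vectors as an additive hom -/
def PhiW (K : Type*) [Field K] [CharP K 2] (n : ℕ) : W2 K →+ W2 K where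
  toFun x := mkW (x.1 ^ 2 ^ n) (x.2 ^ 2 ^ n)
  map_zero' := W2ext (by simp [mkW_fst, W2.fst_zero]) (by simp [mkW_snd, W2.snd_zero])
  map_add' x y := W2ext
    (by simp only [W2.fst_add, mkW_fst, add_pow_char_pow])
    (by simp only [W2.fst_add, W2.snd_add, mkW_fst, mkW_snd, add_pow_char_pow, mul_pow])

theorem PhiW_fst {K : Type*} [Field K] [CharP K 2] (n : ℕ) (x : W2 K) :
    (PhiW K n x).1 = x.1 ^ 2 ^ n := rfl
theorem PhiW_snd {K : Type*} [Field K] [CharP K 2] (n : ℕ) (x : W2 K) :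
    (PhiW K n x).2 = x.2 ^ 2 ^ n := rfl

/-- Teichmueller lift -/
def tei {K : Type*} [Field K] (x : K) : W2 K := mkW x 0

/-- second elementary symmetric function -/
def E2 {K : Type*} [Field K] (n : ℕ) (x : ℕ → K) : K :=
  ∑ j ∈ Finset.range n, ∑ i ∈ Finset.range j, x i * x j

theorem sum_tei {K : Type*} [Field K] [CharP K 2] (n : ℕ) (x : ℕ → K) :
    ∑ j ∈ Finset.range n, tei (x j) = mkW (∑ j ∈ Finset.range n, x j) (E2 n x) := by
  induction n with
  | zero => simp [E2]; rfl
  | succ n ih =>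
    rw [Finset.sum_range_succ, ih]
    apply W2ext
    · rw [W2.fst_add, Finset.sum_range_succ]; rfl
    · rw [W2.snd_add]
      simp only [E2, tei, mkW_fst, mkW_snd]
      rw [Finset.sum_range_succ, ← Finset.sum_mul]; ring

theorem sum_V {K : Type*} [Field K] [CharP K 2] (n : ℕ) (x : ℕ → K) :
    ∑ j ∈ Finset.range n, mkW 0 (x j) = mkW 0 (∑ j ∈ Finset.range n, x j) := by
  induction n with
  | zero => simp; rfl
  | succ n ih =>
    rw [Finset.sum_range_succ, ih]
    apply W2ext
    · rw [W2.fst_add]; simp [mkW_fst]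
    · rw [W2.snd_add, Finset.sum_range_succ]; simp [mkW_fst, mkW_snd]

section
variable {K : Type*} [Field K] [Fintype K] [CharP K 2] (k m : ℕ)

theorem card_pow (hcard : Fintype.card K = 2 ^ (k * m)) (x : K) : x ^ 2 ^ (k * m) = x := by
  rw [← hcard]; exact FiniteField.pow_card x

theorem sum_shift {A : Type*} [AddCommGroup A] (f : ℕ → A) (m : ℕ) (h : f m = f 0) :
    ∑ i ∈ Finset.range m, f (i + 1) = ∑ i ∈ Finset.range m, f i := by
  have h1 := Finset.sum_range_succ f m
  have h2 := Finset.sum_range_succ' f m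
  rw [h1, h] at h2
  exact (add_right_cancel h2).symm

theorem T_Phi (hcard : Fintype.card K = 2 ^ (k * m)) (j : ℕ) (x : W2 K) :
    ∑ i ∈ Finset.range m, PhiW K (k * i) (PhiW K (k * j) x)
      = ∑ i ∈ Finset.range m, PhiW K (k * i) x := by
  induction j with
  | zero => 
    refine Finset.sum_congr rfl fun i _ => congrArg _ ?_
    apply W2ext <;> simp [PhiW_fst, PhiW_snd]
  | succ j ih =>
    rw [← ih, ← sum_shift (fun i => PhiW K (k * i) (PhiW K (k * j) x))]
    · refine Finset.sum_congr rfl fun i _ => ?_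
      apply W2ext <;> simp only [PhiW_fst, PhiW_snd, ← pow_mul, ← pow_add] <;> congr 2 <;> ring
    · apply W2ext <;> simp only [PhiW_fst, PhiW_snd, card_pow k m hcard] <;> simp

theorem trp_Phi (z : K) : ∑ i ∈ Finset.range m, PhiW K (k * i) (mkW 0 z)
    = mkW 0 (trp (2 ^ k) m z) := by
  rw [trp, ← sum_V]
  refine Finset.sum_congr rfl fun i _ => ?_
  apply W2ext <;> simp [PhiW_fst, PhiW_snd, mkW_fst, mkW_snd, pow_mul]

theorem trp_pow (hcard : Fintype.card K = 2 ^ (k * m)) (j : ℕ) (x : K) :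
    trp (2 ^ k) m (x ^ 2 ^ (k * j)) = trp (2 ^ k) m x := by
  have h := T_Phi k m hcard j (mkW 0 x)
  have h2 : PhiW K (k * j) (mkW 0 x) = mkW 0 (x ^ 2 ^ (k * j)) := by
    apply W2ext <;> simp [PhiW_fst, PhiW_snd, mkW_fst, mkW_snd]
  rw [h2, trp_Phi, trp_Phi] at h
  exact (Prod.ext_iff.mp h).2

theorem trp_add (x y : K) : trp (2 ^ k) m (x + y) = trp (2 ^ k) m x + trp (2 ^ k) m y := by
  simp only [trp, ← pow_mul, add_pow_char_pow, Finset.sum_add_distrib]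

theorem trp_zero : trp (2 ^ k) m (0 : K) = 0 := by
  simp [trp]

theorem trp_sum {ι : Type*} (s : Finset ι) (f : ι → K) :
    trp (2 ^ k) m (∑ i ∈ s, f i) = ∑ i ∈ s, trp (2 ^ k) m (f i) :=
  map_sum (AddMonoidHom.mk' (trp (2 ^ k) m) (trp_add k m)) f s

theorem trp_sq (x : K) : trp (2 ^ k) m (x ^ 2) = trp (2 ^ k) m x ^ 2 := by
  rw [trp, trp, sum_pow_char 2]
  refine Finset.sum_congr rfl fun i _ => ?_
  rw [← pow_mul, mul_comm, pow_mul]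

theorem trp_E2 (hcard : Fintype.card K = 2 ^ (k * m)) (n : ℕ) (x : ℕ → K)
    (hx : ∑ j ∈ Finset.range n, x j = 0)
    (hy : ∑ j ∈ Finset.range n, x j ^ 2 ^ (k * j) = 0) :
    trp (2 ^ k) m (E2 n (fun j => x j ^ 2 ^ (k * j))) = trp (2 ^ k) m (E2 n x) := by
  have h1 := sum_tei n x
  have h2 := sum_tei n (fun j => x j ^ 2 ^ (k * j))
  rw [hx] at h1
  rw [hy] at h2
  have key : ∑ i ∈ Finset.range m, PhiW K (k * i)
        (∑ j ∈ Finset.range n, tei (x j ^ 2 ^ (k * j)))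
      = ∑ i ∈ Finset.range m, PhiW K (k * i) (∑ j ∈ Finset.range n, tei (x j)) := by
    simp only [map_sum]
    rw [Finset.sum_comm]
    conv_rhs => rw [Finset.sum_comm]
    refine Finset.sum_congr rfl fun j _ => ?_
    rw [← T_Phi k m hcard j (tei (x j))]
    refine Finset.sum_congr rfl fun i _ => ?_
    congr 1
    apply W2ext <;> simp [PhiW_fst, PhiW_snd, mkW_fst, mkW_snd, tei]
  rw [h1, h2, trp_Phi, trp_Phi] at key
  exact (Prod.ext_iff.mp key).2

theorem trp_adj (hcard : Fintype.card K = 2 ^ (k * m)) (e : ℕ) (b : ℕ → K) (t u : K) :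
    trp (2 ^ k) m (adj k e b t * u) = trp (2 ^ k) m (t * Lpoly (2 ^ k) e b u) := by
  rw [adj, Lpoly, Finset.sum_mul, Finset.mul_sum, trp_sum, trp_sum]
  refine Finset.sum_congr rfl fun i _ => ?_
  rw [← trp_pow k m hcard i, mul_pow, rt_pow, pow_mul]
  congr 1; ring

theorem gammaF_eq (e : ℕ) (b : ℕ → K) (u : K) :
    gammaF k e b * u ^ 2 = E2 (e + 1) (fun j => rt K (k * j) (b j) * u) := by
  rw [gammaF, E2, Finset.sum_comm' (t' := Finset.range (e + 1)) (s' := fun j => Finset.range j)]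
  · simp only [Finset.sum_mul]
    refine Finset.sum_congr rfl fun i _ => Finset.sum_congr rfl fun j _ => ?_
    ring
  · intro x y; simp only [Finset.mem_range, Finset.mem_Ioo]; omega

theorem trp_RF (hcard : Fintype.card K = 2 ^ (k * m)) (e : ℕ) (b : ℕ → K) (u : K) :
    trp (2 ^ k) m (u * RF k e b u)
      = trp (2 ^ k) m (E2 (e + 1) (fun j => b j * u ^ 2 ^ (k * j))) := by
  simp only [RF, aRF, E2, Finset.sum_mul, Finset.mul_sum, trp_sum]
  rw [Finset.sum_sigma', Finset.sum_sigma']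
  refine Finset.sum_nbij' (fun z => ⟨z.2 + z.1, z.2⟩) (fun z => ⟨z.1 - z.2, z.2⟩) ?_ ?_ ?_ ?_ ?_
  · rintro ⟨i, j⟩ h; simp at h ⊢; omega
  · rintro ⟨i, j⟩ h; simp at h ⊢; omega
  · rintro ⟨i, j⟩ h; simp
  · rintro ⟨i, j⟩ h; simp at h ⊢; omega
  · rintro ⟨i, j⟩ h
    simp only
    rw [← trp_pow k m hcard j, mul_pow, mul_pow, rt_pow, ← pow_mul, ← pow_mul, ← pow_add,
      show k * i + k * j = k * (j + i) by ring]
    congr 1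
    ring

theorem adj_one_zero (e : ℕ) (b : ℕ → K) (hb2 : adjBar k e b 1 = 0) :
    ∑ j ∈ Finset.range (e + 1), rt K (k * j) (b j) = 0 := by
  apply (algebraMap K (AlgebraicClosure K)).injective
  rw [map_sum, map_zero, ← hb2, adjBar, adj]
  refine Finset.sum_congr rfl fun i _ => ?_
  rw [mul_one]
  exact (rt_eq _ (by rw [← map_pow, rt_pow])).symm

theorem trp_main (hcard : Fintype.card K = 2 ^ (k * m)) (e : ℕ) (b : ℕ → K)
    (hb2 : adjBar k e b 1 = 0) (u : K) (hu : Lpoly (2 ^ k) e b u = 0) :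
    trp (2 ^ k) m (u * RF k e b u) = trp (2 ^ k) m (gammaF k e b * u ^ 2) := by
  rw [trp_RF k m hcard, gammaF_eq]
  have h : ∀ j, (rt K (k * j) (b j) * u) ^ 2 ^ (k * j) = b j * u ^ 2 ^ (k * j) := fun j => by
    rw [mul_pow, rt_pow]
  rw [← trp_E2 k m hcard (e + 1) (fun j => rt K (k * j) (b j) * u)]
  · simp only [h]
  · rw [← Finset.sum_mul, adj_one_zero k e b hb2, zero_mul]
  · simp only [h]
    simpa only [Lpoly, ← pow_mul] using hu

theorem tr2_trp (x : K) : tr2 (k * m) x = ∑ j ∈ Finset.range k, trp (2 ^ k) m x ^ 2 ^ j := by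
  simp only [tr2, trp, sum_pow_char_pow, ← pow_mul, ← pow_add]
  rw [Finset.sum_comm]
  induction m with
  | zero => simp
  | succ m ih => rw [Nat.mul_succ, Finset.sum_range_add, ih, Finset.sum_range_succ]

theorem rt_add (j : ℕ) (x y : K) : rt K j (x + y) = rt K j x + rt K j y :=
  rt_eq j (by rw [add_pow_char_pow, rt_pow, rt_pow])

theorem adj_add (e : ℕ) (b : ℕ → K) (x y : K) :
    adj k e b (x + y) = adj k e b x + adj k e b y := by
  simp only [adj, mul_add, rt_add, Finset.sum_add_distrib]

theorem mem_range_adj (hcard : Fintype.card K = 2 ^ (k * m)) (e : ℕ) (b : ℕ → K) (s : K)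
    (hs : ∀ u : K, Lpoly (2 ^ k) e b u = 0 → trp (2 ^ k) m (s * u) = 0) :
    ∃ t, adj k e b t = s := by
  letI : Algebra (ZMod 2) K := ZMod.algebra K 2
  have htr : ∀ x : K, algebraMap (ZMod 2) K (Algebra.trace (ZMod 2) K x) = tr2 (k * m) x := by
    intro x
    have hr : Module.finrank (ZMod 2) K = k * m := by
      have := Module.card_eq_pow_finrank (K := ZMod 2) (V := K)
      rw [hcard, ZMod.card] at this
      exact (Nat.pow_right_injective le_rfl this).symm
    rw [FiniteField.algebraMap_trace_eq_sum_pow, hr, tr2]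
    simp
  by_contra hcon
  let f : K →ₗ[ZMod 2] K := (AddMonoidHom.mk' (adj k e b) (adj_add k e b)).toZModLinearMap 2
  have hns : s ∉ LinearMap.range f := fun ⟨t, ht⟩ => hcon ⟨t, ht⟩
  obtain ⟨g, hg, hle⟩ := Submodule.exists_le_ker_of_notMem hns
  have hnd := traceForm_nondegenerate (ZMod 2) K
  let u := (LinearMap.BilinForm.toDual _ hnd).symm g
  have hu : ∀ x, Algebra.trace (ZMod 2) K (u * x) = g x := fun x =>
    LinearMap.BilinForm.apply_toDual_symm_apply (hB := hnd) g x
  have hF : Lpoly (2 ^ k) e b u = 0 := by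
    apply hnd.1
    intro t
    rw [Algebra.traceForm_apply]
    apply (algebraMap (ZMod 2) K).injective
    rw [htr, tr2_trp, mul_comm, ← trp_adj k m hcard, ← tr2_trp, ← htr, mul_comm, hu]
    have : f t ∈ LinearMap.ker g := hle ⟨t, rfl⟩
    rw [show g (adj k e b t) = 0 from this]
  apply hg
  apply (algebraMap (ZMod 2) K).injective
  rw [← hu, htr, tr2_trp, mul_comm, hs u hF]
  simp

end

/-- `α_F(𝔽_q) = {a ∈ 𝔽_q ∣ Tr_{q/p}(u R_F(u) + a u²) = 0 for all
u ∈ W_{F,q}}`. -/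
theorem statement19 {K : Type*} [Field K] [Fintype K] [CharP K 2]
    (k m e : ℕ) (hk : 1 ≤ k) (hm : 1 ≤ m) (he : 1 ≤ e)
    (hcard : Fintype.card K = 2 ^ (k * m))
    (b : ℕ → K)
    (hb1 : b 0 * b e ≠ 0)
    (hb2 : adjBar k e b 1 = 0) :
    Set.range (alphaF k e b)
      = {a : K | ∀ u : K, Lpoly (2 ^ k) e b u = 0 →
          trp (2 ^ k) m (u * RF k e b u + a * u ^ 2) = 0} := by
  ext a
  simp only [Set.mem_range, Set.mem_setOf_eq]
  have hred : ∀ s u : K, Lpoly (2 ^ k) e b u = 0 →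
      trp (2 ^ k) m (u * RF k e b u + (gammaF k e b + s ^ 2) * u ^ 2)
        = trp (2 ^ k) m (s * u) ^ 2 := by
    intro s u hu
    rw [add_mul, trp_add, trp_add, trp_main k m hcard e b hb2 u hu, ← add_assoc,
      CharTwo.add_self_eq_zero, zero_add, ← mul_pow, trp_sq]
  constructor
  · rintro ⟨t, rfl⟩ u hu
    rw [alphaF, hred _ _ hu, trp_adj k m hcard, hu, mul_zero, trp_zero]
    simp
  · intro h
    have hs : rt K 1 (gammaF k e b + a) ^ 2 = gammaF k e b + a := by
      simpa using rt_pow 1 (gammaF k e b + a)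
    have ha : gammaF k e b + rt K 1 (gammaF k e b + a) ^ 2 = a := by
      rw [hs, ← add_assoc, CharTwo.add_self_eq_zero, zero_add]
    obtain ⟨t, ht⟩ := mem_range_adj k m hcard e b (rt K 1 (gammaF k e b + a)) (by
      intro u hu
      have h1 := h u hu
      rw [← ha, hred _ _ hu] at h1
      exact pow_eq_zero_iff (two_ne_zero) |>.mp h1)
    exact ⟨t, by rw [alphaF, ht, ha]⟩

end
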